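/- Let a and b be non-negative integers and let (A_1,B_1),...,(A_m,B_m) be a skew Bollobás system with |A_i| ≤ a and |B_i| ≤ b for every i ∈ {1,...,m}. Then |B_1 ∪ B_2 ∪ ... ∪ B_m| ≤ C(a+b+1, a+1) − 1, where C denotes the binomial coefficient. -/

import Mathlib

/-- A skew Bollobás system: pairs `(A i, B i)` of finite sets with `A i ∩ B i = ∅`
and `A i ∩ B j ≠ ∅` whenever `i < j`. -/
def IsSkewBollobasSystem (m : ℕ) (A B : Fin m → Finset ℕ) : Prop :=
  (∀ i, Disjoint (A i) (B i)) ∧ (∀ i j : Fin m, i < j → (A i ∩ B j).Nonempty)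

/-- The skew version of the Bollobás set-pair inequality. -/
theorem card_le_choose_of_skew {ι : Type*} [Fintype ι] [LinearOrder ι] {a b : ℕ}
    {A B : ι → Finset ℕ} (hd : ∀ i, Disjoint (A i) (B i))
    (hi : ∀ i j, i < j → (A i ∩ B j).Nonempty)
    (hA : ∀ i, (A i).card ≤ a) (hB : ∀ i, (B i).card ≤ b) :
    Fintype.card ι ≤ (a + b).choose a := by
  classical
  let p : ι → Polynomial ℚ := fun i => ∏ x ∈ A i, (Polynomial.X - Polynomial.C (x : ℚ))
  have hpeval (i : ι) (z : ℚ) : (p i).eval z = ∏ x ∈ A i, (z - x) := by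
    simp [p, Polynomial.eval_prod]
  have hpdeg (i : ι) : (p i).natDegree < a + 1 := by
    have h : (p i).natDegree = (A i).card := Polynomial.natDegree_finsetProd_X_sub_C_eq_card _ _
    have := hA i
    omega
  -- Enumerate `B j` by `Fin b`, padding with `-1`, which is a root of no `p i`.
  have hy (j : ι) : ∃ y : Fin b → ℚ, (∀ x ∈ B j, ∃ t, y t = x) ∧
      ∀ t, y t = -1 ∨ ∃ x ∈ B j, y t = x := by
    refine ⟨fun t => if h : (t : ℕ) < (B j).card then (((B j).equivFin.symm ⟨t, h⟩ : B j) : ℕ)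
      else -1, fun x hx => ?_, fun t => ?_⟩
    · refine ⟨⟨(B j).equivFin ⟨x, hx⟩, ((B j).equivFin ⟨x, hx⟩).2.trans_le (hB j)⟩, ?_⟩
      simp
    · by_cases h : (t : ℕ) < (B j).card
      · right
        exact ⟨_, ((B j).equivFin.symm ⟨t, h⟩).2, by simp [h]⟩
      · left
        simp [h]
  choose y hy_mem hy_val using hy
  let M : Matrix ι ι ℚ := fun i j => ∏ t, (p i).eval (y j t)
  let P : Matrix ι (Sym (Fin (a + 1)) b) ℚ := fun i s =>
    ((s : Multiset (Fin (a + 1))).map fun k : Fin (a + 1) => (p i).coeff (k : ℕ)).prod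
  let σ : (Fin b → Fin (a + 1)) → Sym (Fin (a + 1)) b := fun g =>
    ⟨Finset.univ.val.map g, by simp⟩
  let Q : Matrix (Sym (Fin (a + 1)) b) ι ℚ := fun s j =>
    ∑ g with σ g = s, ∏ t, y j t ^ (g t : ℕ)
  have hM : M = P * Q := by
    ext i j
    have h1 : M i j = ∑ g : Fin b → Fin (a + 1),
        ∏ t, ((p i).coeff (g t) * y j t ^ (g t : ℕ)) := by
      simp only [M, Polynomial.eval_eq_sum_range' (hpdeg i), Finset.sum_range]
      rw [Finset.prod_univ_sum, Fintype.piFinset_univ]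
    rw [h1, Matrix.mul_apply, ← Finset.sum_fiberwise Finset.univ σ]
    refine Finset.sum_congr rfl fun s _ => ?_
    rw [Finset.mul_sum]
    refine Finset.sum_congr rfl fun g hg => ?_
    obtain rfl := (Finset.mem_filter.1 hg).2
    rw [Finset.prod_mul_distrib]
    congr 1
    simp only [P, σ, Sym.coe_mk, Multiset.map_map]
    rfl
  have hlow : M.BlockTriangular OrderDual.toDual := by
    intro i j hij
    obtain ⟨x, hx⟩ := hi i j hij
    rw [Finset.mem_inter] at hx
    obtain ⟨t, ht⟩ := hy_mem j x hx.2
    refine Finset.prod_eq_zero (Finset.mem_univ t) ?_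
    rw [hpeval, ht]
    exact Finset.prod_eq_zero hx.1 (sub_self _)
  have hdet : M.det ≠ 0 := by
    rw [Matrix.det_of_isLowerTriangular M hlow, Finset.prod_ne_zero_iff]
    intro i _
    refine Finset.prod_ne_zero_iff.2 fun t _ => ?_
    rw [hpeval]
    refine Finset.prod_ne_zero_iff.2 fun x hx => ?_
    rcases hy_val i t with h | ⟨z, hz, h⟩
    · rw [h]
      have : (0 : ℚ) ≤ x := Nat.cast_nonneg x
      linarith
    · rw [h, sub_ne_zero, Ne, Nat.cast_inj]
      rintro rfl
      exact Finset.disjoint_left.1 (hd i) hx hz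
  calc Fintype.card ι = M.rank :=
        (Matrix.rank_of_isUnit M ((Matrix.isUnit_iff_isUnit_det M).2 hdet.isUnit)).symm
    _ ≤ P.rank := hM ▸ Matrix.rank_mul_le_left P Q
    _ ≤ Fintype.card (Sym (Fin (a + 1)) b) := Matrix.rank_le_card_width P
    _ = (a + b).choose a := by
        rw [Sym.card_sym_eq_choose, Fintype.card_fin, show a + 1 + b - 1 = a + b by omega]
        exact (Nat.choose_symm_add).symm

/-- Every finite cover has a subcover in which each member has a private point. -/
theorem exists_subcover_private {ι : Type*} [DecidableEq ι] (B : ι → Finset ℕ) (I : Finset ι) :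
    ∃ J ⊆ I, J.biUnion B = I.biUnion B ∧
      ∃ x : ι → ℕ, ∀ j ∈ J, x j ∈ B j ∧ ∀ k ∈ J, x j ∈ B k → k = j := by
  induction I using Finset.strongInduction with
  | H I ih =>
    by_cases h : ∀ j ∈ I, ∃ x, x ∈ B j ∧ ∀ k ∈ I, x ∈ B k → k = j
    · choose! x hx using h
      exact ⟨I, subset_rfl, rfl, x, hx⟩
    · push Not at h
      obtain ⟨j, hj, h⟩ := h
      obtain ⟨J, hJ, hU, hx⟩ := ih (I.erase j) (Finset.erase_ssubset hj)
      refine ⟨J, hJ.trans (Finset.erase_subset _ _), hU.trans ?_, hx⟩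
      refine (Finset.biUnion_subset_biUnion_of_subset_left B (Finset.erase_subset _ _)).antisymm ?_
      intro z hz
      obtain ⟨i, hiI, hzi⟩ := Finset.mem_biUnion.1 hz
      rw [Finset.mem_biUnion]
      by_cases hij : i = j
      · subst hij
        obtain ⟨k, hk, hzk, hki⟩ := h z hzi
        exact ⟨k, Finset.mem_erase.2 ⟨hki, hk⟩, hzk⟩
      · exact ⟨i, Finset.mem_erase.2 ⟨hij, hiI⟩, hzi⟩

theorem card_biUnion_lt_choose_of_skew {ι : Type*} [LinearOrder ι] (a b : ℕ) (I : Finset ι)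
    (A B : ι → Finset ℕ) (hd : ∀ i ∈ I, Disjoint (A i) (B i))
    (hi : ∀ i ∈ I, ∀ j ∈ I, i < j → (A i ∩ B j).Nonempty)
    (hA : ∀ i ∈ I, (A i).card ≤ a) (hB : ∀ i ∈ I, (B i).card ≤ b) :
    (I.biUnion B).card < (a + b + 1).choose (a + 1) := by
  classical
  induction b generalizing I A B with
  | zero =>
    have : I.biUnion B = ∅ := by
      refine Finset.eq_empty_of_forall_notMem fun z hz => ?_
      obtain ⟨i, hiI, hzi⟩ := Finset.mem_biUnion.1 hz
      rw [Finset.card_eq_zero.1 (Nat.le_zero.1 (hB i hiI))] at hzi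
      exact Finset.notMem_empty z hzi
    simp [this]
  | succ b ih =>
    obtain ⟨J, hJI, hJU, x, hx⟩ := exists_subcover_private B I
    let X := J.image x
    obtain ⟨K, hKJ, hKU, x', hx'⟩ := exists_subcover_private (fun i => B i \ X) J
    have hX : X.card ≤ (a + (b + 1)).choose a := by
      refine Finset.card_image_le.trans ?_
      rw [← Fintype.card_coe]
      exact card_le_choose_of_skew (A := fun i : J => A i) (B := fun i : J => B i)
        (fun i => hd i (hJI i.2)) (fun i j => hi i (hJI i.2) j (hJI j.2))
        (fun i => hA i (hJI i.2)) (fun i => hB i (hJI i.2))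
    -- Replacing each old private point by the next one keeps the system skew.
    let φ : ℕ → ℕ := fun z => if h : ∃ j ∈ K, x j = z then x' h.choose else z
    have hφx (j : ι) (hj : j ∈ K) : φ (x j) = x' j := by
      have h : ∃ k ∈ K, x k = x j := ⟨j, hj, rfl⟩
      have heq : h.choose = j := by
        refine ((hx _ (hKJ h.choose_spec.1)).2 j (hKJ hj) ?_).symm
        rw [h.choose_spec.2]
        exact (hx j (hKJ hj)).1
      simp only [φ, dif_pos h, heq]
    have hφ (z : ℕ) (hz : ¬ ∃ j ∈ K, x j = z) : φ z = z := dif_neg hz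
    have key := ih K (fun i => (A i).image φ) (fun i => B i \ X) ?_ ?_ ?_ ?_
    · rw [hKU] at key
      have hsub : I.biUnion B ⊆ J.biUnion (fun i => B i \ X) ∪ X := by
        rw [← hJU]
        intro z hz
        obtain ⟨i, hiJ, hzi⟩ := Finset.mem_biUnion.1 hz
        by_cases hzX : z ∈ X
        · exact Finset.mem_union_right _ hzX
        · exact Finset.mem_union_left _
            (Finset.mem_biUnion.2 ⟨i, hiJ, Finset.mem_sdiff.2 ⟨hzi, hzX⟩⟩)
      have hcard := (Finset.card_le_card hsub).trans (Finset.card_union_le _ _)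
      have hpascal := Nat.choose_succ_succ' (a + (b + 1)) a
      rw [← add_assoc] at hpascal hX
      rw [← add_assoc, hpascal]
      omega
    · intro i hiK
      rw [Finset.disjoint_left]
      intro w hw hwB
      obtain ⟨z, hz, rfl⟩ := Finset.mem_image.1 hw
      by_cases h : ∃ j ∈ K, x j = z
      · obtain ⟨j, hj, rfl⟩ := h
        rw [hφx j hj] at hwB
        obtain rfl := (hx' j hj).2 i hiK hwB
        exact Finset.disjoint_left.1 (hd i (hJI (hKJ hiK))) hz (hx i (hKJ hiK)).1
      · rw [hφ z h] at hwB
        exact Finset.disjoint_left.1 (hd i (hJI (hKJ hiK))) hz (Finset.mem_sdiff.1 hwB).1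
    · intro i hiK j hjK hij
      obtain ⟨z, hz⟩ := hi i (hJI (hKJ hiK)) j (hJI (hKJ hjK)) hij
      rw [Finset.mem_inter] at hz
      refine ⟨φ z, Finset.mem_inter.2 ⟨Finset.mem_image_of_mem φ hz.1, ?_⟩⟩
      by_cases h : z = x j
      · rw [h, hφx j hjK]
        exact (hx' j hjK).1
      · have hzX : z ∉ X := by
          intro hzX
          obtain ⟨k, hk, rfl⟩ := Finset.mem_image.1 hzX
          exact h (by rw [(hx k hk).2 j (hKJ hjK) hz.2])
        rw [hφ z fun ⟨k, hk, hkz⟩ => hzX (Finset.mem_image.2 ⟨k, hKJ hk, hkz⟩)]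
        exact Finset.mem_sdiff.2 ⟨hz.2, hzX⟩
    · exact fun i hiK => Finset.card_image_le.trans (hA i (hJI (hKJ hiK)))
    · intro i hiK
      have hlt : (B i \ X).card < (B i).card := by
        refine Finset.card_lt_card (Finset.ssubset_iff_subset_ne.2 ⟨Finset.sdiff_subset, ?_⟩)
        intro h
        have hxi := (hx i (hKJ hiK)).1
        rw [← h] at hxi
        exact (Finset.mem_sdiff.1 hxi).2 (Finset.mem_image_of_mem x (hKJ hiK))
      have := hB i (hJI (hKJ hiK))
      omega

/-- Upper bound: any skew Bollobás system with `|A i| ≤ a`, `|B i| ≤ b`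
satisfies `|B 1 ∪ ⋯ ∪ B m| ≤ C(a+b+1, a+1) - 1`. -/
theorem union_B_card_le (a b m : ℕ)
    (A B : Fin m → Finset ℕ) (hsys : IsSkewBollobasSystem m A B)
    (hA : ∀ i, (A i).card ≤ a) (hB : ∀ i, (B i).card ≤ b) :
    (Finset.univ.biUnion B).card ≤ (a + b + 1).choose (a + 1) - 1 :=
  Nat.le_sub_one_of_lt <| card_biUnion_lt_choose_of_skew a b Finset.univ A B
    (fun i _ => hsys.1 i) (fun i _ j _ => hsys.2 i j) (fun i _ => hA i) (fun i _ => hB i)
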